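/- Let X, Y, Z be Polish path spaces with N time steps, let μ ∈ P(X), ν ∈ P(Y), γ ∈ P(Z), and let π ∈ Π_c(μ, ν) with disintegration π = μ ⊗ K and π̃ ∈ Π_c(ν, γ) with disintegration π̃ = ν ⊗ K̃, where K : X → P(Y) and K̃ : Y → P(Z) are measurable kernels. Then the measure μ ⊗ (K ∗ K̃) obtained by concatenating the kernels is a causal coupling, i.e. μ ⊗ (K ∗ K̃) ∈ Π_c(μ, γ). -/

import Mathlib

open MeasureTheory ProbabilityTheory Filter Set
open scoped ENNReal NNReal Topology ProbabilityTheory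

noncomputable section

namespace AOT

variable {N : ℕ}

/-- The σ-algebra on a path space generated by the `t`-th coordinate. -/
def coordσ (X : Fin N → Type*) [∀ t, MeasurableSpace (X t)] (t : Fin N) :
    MeasurableSpace (∀ s, X s) :=
  MeasurableSpace.comap (fun x => x t) inferInstance

/-- The σ-algebra generated by the coordinates (strictly) before time `t`, from a family
of coordinate σ-algebras. -/
def pastσOf {A : Type*} (m : Fin N → MeasurableSpace A) (t : ℕ) : MeasurableSpace A :=
  ⨆ s : Fin N, ⨆ _ : (s : ℕ) < t, m s

/-- The σ-algebra on a path space generated by the coordinates before time `t`. -/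
def pastσ (X : Fin N → Type*) [∀ t, MeasurableSpace (X t)] (t : ℕ) :
    MeasurableSpace (∀ s, X s) :=
  pastσOf (coordσ X) t

/-- Conditional independence of the sub-σ-algebras `m₁` and `m₂` given `m₃`, under the
measure `π`: for all sets `A ∈ m₁`, `B ∈ m₂`, the conditional expectation (given `m₃`)
of the indicator of `A ∩ B` is a.s. the product of those of `A` and of `B`. -/
def CondIndepσ {Ω : Type*} {mΩ : MeasurableSpace Ω} (m₁ m₂ m₃ : MeasurableSpace Ω)
    (π : @Measure Ω mΩ) : Prop :=
  ∀ A B : Set Ω, MeasurableSet[m₁] A → MeasurableSet[m₂] B →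
    (π[(A ∩ B).indicator (fun _ => (1 : ℝ)) | m₃]) =ᵐ[π]
      (π[A.indicator (fun _ => (1 : ℝ)) | m₃]) * (π[B.indicator (fun _ => (1 : ℝ)) | m₃])

/-- Causality of a measure on `A × B` relative to families of coordinate σ-algebras
`mA` on `A` and `mB` on `B`: for every time `t`, the `t`-th coordinate of the first
component is conditionally independent of the (strict) past of the second component,
given the (strict) past of the first component. -/
def IsCausalFor {A B : Type*} [MeasurableSpace A] [MeasurableSpace B]
    (mA : Fin N → MeasurableSpace A) (mB : Fin N → MeasurableSpace B)
    (π : Measure (A × B)) : Prop :=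
  ∀ t : Fin N,
    CondIndepσ ((mA t).comap Prod.fst)
      ((pastσOf mB (t : ℕ)).comap Prod.snd)
      ((pastσOf mA (t : ℕ)).comap Prod.fst) π

/-- Anticausality: causality with the roles of the two components exchanged. -/
def IsAnticausalFor {A B : Type*} [MeasurableSpace A] [MeasurableSpace B]
    (mA : Fin N → MeasurableSpace A) (mB : Fin N → MeasurableSpace B)
    (π : Measure (A × B)) : Prop :=
  IsCausalFor mB mA (π.map Prod.swap)

/-- A coupling of a measure on `X₁ × ⋯ × X_N` and a measure on `Y₁ × ⋯ × Y_N` is causal if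
under it, for every `t`, `Y_{1:t}` is conditionally independent of `X_{t+1}` given `X_{1:t}`. -/
def IsCausal {X Y : Fin N → Type*} [∀ t, MeasurableSpace (X t)] [∀ t, MeasurableSpace (Y t)]
    (π : Measure ((∀ t, X t) × (∀ t, Y t))) : Prop :=
  IsCausalFor (coordσ X) (coordσ Y) π

def IsAnticausal {X Y : Fin N → Type*} [∀ t, MeasurableSpace (X t)] [∀ t, MeasurableSpace (Y t)]
    (π : Measure ((∀ t, X t) × (∀ t, Y t))) : Prop :=
  IsAnticausalFor (coordσ X) (coordσ Y) π

def IsBicausal {X Y : Fin N → Type*} [∀ t, MeasurableSpace (X t)] [∀ t, MeasurableSpace (Y t)]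
    (π : Measure ((∀ t, X t) × (∀ t, Y t))) : Prop :=
  IsCausal π ∧ IsAnticausal π

/-- `π` is a coupling of `μ` and `ν`. -/
def IsCoupling {A B : Type*} [MeasurableSpace A] [MeasurableSpace B]
    (μ : Measure A) (ν : Measure B) (π : Measure (A × B)) : Prop :=
  π.map Prod.fst = μ ∧ π.map Prod.snd = ν

/-- The four flavors of (adapted) optimal transport: plain, causal, anticausal, bicausal. -/
inductive Flavor | plain | causal | anticausal | bicausal

/-- The adaptedness constraint corresponding to a flavor. -/
def IsAdapted {X Y : Fin N → Type*} [∀ t, MeasurableSpace (X t)] [∀ t, MeasurableSpace (Y t)] :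
    Flavor → Measure ((∀ t, X t) × (∀ t, Y t)) → Prop
  | .plain => fun _ => True
  | .causal => fun π => IsCausal π
  | .anticausal => fun π => IsAnticausal π
  | .bicausal => fun π => IsBicausal π

/-- The set `Π_•(μ, ν)` of couplings of `μ` and `ν` with the adaptedness constraint
given by the flavor `b`. -/
def aCouplings {X Y : Fin N → Type*} [∀ t, MeasurableSpace (X t)] [∀ t, MeasurableSpace (Y t)]
    (b : Flavor) (μ : Measure (∀ t, X t)) (ν : Measure (∀ t, Y t)) :
    Set (Measure ((∀ t, X t) × (∀ t, Y t))) :=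
  {π | IsCoupling μ ν π ∧ IsAdapted b π}

/-- `p`-th power transport cost of a coupling. -/
def lcost (p : ℝ) {A : Type*} [MeasurableSpace A] [PseudoEMetricSpace A]
    (π : Measure (A × A)) : ℝ≥0∞ :=
  ∫⁻ z, edist z.1 z.2 ^ p ∂π

/-- The (adapted) Wasserstein distance `W_{p,•}` between two measures on a path space. -/
def W {X : Fin N → Type*} [∀ t, MeasurableSpace (X t)] [∀ t, PseudoEMetricSpace (X t)]
    (p : ℝ) (b : Flavor) (μ ν : Measure (∀ t, X t)) : ℝ≥0∞ :=
  (⨅ π : aCouplings b μ ν, lcost p π.1) ^ (1 / p)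

/-- Coordinate σ-algebras on `X × Y` viewed as a single path space with
coordinates `X_t × Y_t`. -/
def coordσ2 (X Y : Fin N → Type*) [∀ t, MeasurableSpace (X t)] [∀ t, MeasurableSpace (Y t)]
    (t : Fin N) : MeasurableSpace ((∀ s, X s) × (∀ s, Y s)) :=
  ((coordσ X t).comap Prod.fst) ⊔ ((coordσ Y t).comap Prod.snd)

/-- Adaptedness for measures on `(X × Y) × (X × Y)`, where `X × Y` is regarded as a single
path space with `N` time steps, the `t`-th coordinate being `X_t × Y_t`. -/
def IsAdapted2 {X Y : Fin N → Type*} [∀ t, MeasurableSpace (X t)] [∀ t, MeasurableSpace (Y t)] :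
    Flavor → Measure (((∀ t, X t) × (∀ t, Y t)) × ((∀ t, X t) × (∀ t, Y t))) → Prop
  | .plain => fun _ => True
  | .causal => fun θ => IsCausalFor (coordσ2 X Y) (coordσ2 X Y) θ
  | .anticausal => fun θ => IsAnticausalFor (coordσ2 X Y) (coordσ2 X Y) θ
  | .bicausal => fun θ => IsCausalFor (coordσ2 X Y) (coordσ2 X Y) θ ∧
      IsAnticausalFor (coordσ2 X Y) (coordσ2 X Y) θ

/-- The set `Π_•(π, π̃)` of couplings of two measures on `X × Y`, with adaptedness understood
for `X × Y` as one path space. -/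
def aCouplings2 {X Y : Fin N → Type*} [∀ t, MeasurableSpace (X t)] [∀ t, MeasurableSpace (Y t)]
    (b : Flavor) (π ρ : Measure ((∀ t, X t) × (∀ t, Y t))) :
    Set (Measure (((∀ t, X t) × (∀ t, Y t)) × ((∀ t, X t) × (∀ t, Y t)))) :=
  {θ | IsCoupling π ρ θ ∧ IsAdapted2 b θ}

/-- `p`-th power transport cost `∫ d_X(x,x̃)^p + d_Y(y,ỹ)^p dθ` for couplings of couplings. -/
def lcost2 (p : ℝ) {A B : Type*} [MeasurableSpace A] [MeasurableSpace B]
    [PseudoEMetricSpace A] [PseudoEMetricSpace B]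
    (θ : Measure ((A × B) × (A × B))) : ℝ≥0∞ :=
  ∫⁻ z, (edist z.1.1 z.2.1 ^ p + edist z.1.2 z.2.2 ^ p) ∂θ

/-- The (adapted) Wasserstein distance `W_{p,•}(π, π̃)` between couplings, with cost
`d_X^p + d_Y^p` and `X × Y` regarded as one path space. -/
def W2 {X Y : Fin N → Type*} [∀ t, MeasurableSpace (X t)] [∀ t, MeasurableSpace (Y t)]
    [∀ t, PseudoEMetricSpace (X t)] [∀ t, PseudoEMetricSpace (Y t)]
    (p : ℝ) (b : Flavor) (π ρ : Measure ((∀ t, X t) × (∀ t, Y t))) : ℝ≥0∞ :=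
  (⨅ θ : aCouplings2 b π ρ, lcost2 p θ.1) ^ (1 / p)

/- Relative entropy (Kullback-Leibler divergence): `D_KL(π, ρ) = ∫ log (dπ/dρ) dπ` if
`π ≪ ρ` and the integral is defined, and `∞` otherwise. -/
open Classical in
def KL {Ω : Type*} [MeasurableSpace Ω] (π ρ : Measure Ω) : ℝ≥0∞ :=
  if π ≪ ρ ∧ Integrable (llr π ρ) π then ENNReal.ofReal (∫ ω, llr π ρ ω ∂π) else ⊤

/-- The transport value `V_•(μ, ν, c)`. -/
def V {X Y : Fin N → Type*} [∀ t, MeasurableSpace (X t)] [∀ t, MeasurableSpace (Y t)]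
    (b : Flavor) (μ : Measure (∀ t, X t)) (ν : Measure (∀ t, Y t))
    (c : (∀ t, X t) × (∀ t, Y t) → ℝ) : ℝ :=
  ⨅ π : aCouplings b μ ν, ∫ z, c z ∂π.1

/-- The entropic objective `∫ c dπ + ε D_KL(π, P)`, valued in `EReal`. -/
def entObj {Ω : Type*} [MeasurableSpace Ω] (c : Ω → ℝ) (ε : ℝ) (P : Measure Ω)
    (π : Measure Ω) : EReal :=
  ((∫ z, c z ∂π : ℝ) : EReal) + (ε : EReal) * ((KL π P : ℝ≥0∞) : EReal)

/-- The entropic transport value `E_•^ε(μ, ν, c)`, valued in `EReal`. -/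
def EE {X Y : Fin N → Type*} [∀ t, MeasurableSpace (X t)] [∀ t, MeasurableSpace (Y t)]
    (b : Flavor) (μ : Measure (∀ t, X t)) (ν : Measure (∀ t, Y t))
    (c : (∀ t, X t) × (∀ t, Y t) → ℝ) (ε : ℝ) : EReal :=
  ⨅ π : aCouplings b μ ν, entObj c ε (μ.prod ν) π.1

/-- The kernel `K(x, y) := K^μ(x) ⊗ K^ν(y)` used to build the shadow. -/
def shadowKernel {A A' B B' : Type*} [MeasurableSpace A] [MeasurableSpace A']
    [MeasurableSpace B] [MeasurableSpace B']
    (Kμ : Kernel A A') (Kν : Kernel B B') : Kernel (A × B) (A' × B') :=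
  (Kμ.comap Prod.fst measurable_fst) ×ₖ (Kν.comap Prod.snd measurable_snd)

/-- The `(K^μ, K^ν)`-shadow of `π`: the second marginal of `π ⊗ (K^μ ⊗ K^ν)`. -/
def shadow {A A' B B' : Type*} [MeasurableSpace A] [MeasurableSpace A']
    [MeasurableSpace B] [MeasurableSpace B']
    (π : Measure (A × B)) (Kμ : Kernel A A') (Kν : Kernel B B') : Measure (A' × B') :=
  (π ⊗ₘ (shadowKernel Kμ Kν)).map Prod.snd

/-- `μ` has a finite `p`-th moment. -/
def MemPp {A : Type*} [MeasurableSpace A] [PseudoEMetricSpace A] (p : ℝ) (μ : Measure A) :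
    Prop :=
  ∀ x₀ : A, ∫⁻ x, edist x₀ x ^ p ∂μ ≠ ⊤

/-- `c` has growth of order at most `p`. -/
def GrowthLE {A B : Type*} [PseudoEMetricSpace A] [PseudoEMetricSpace B]
    (p : ℝ) (c : A × B → ℝ) : Prop :=
  ∃ (x₀ : A) (y₀ : B) (M : ℝ), ∀ z : A × B,
    |c z| ≤ M * (1 + (edist x₀ z.1).toReal ^ p + (edist y₀ z.2).toReal ^ p)

/-- Weak convergence of a sequence of measures (testing against bounded continuous
functions). -/
def WeakTendsto {A : Type*} [MeasurableSpace A] [TopologicalSpace A]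
    (πs : ℕ → Measure A) (π : Measure A) : Prop :=
  ∀ f : BoundedContinuousFunction A ℝ,
    Tendsto (fun n => ∫ x, f x ∂(πs n)) atTop (𝓝 (∫ x, f x ∂π))

/-- A finitely supported (discrete) measure. -/
def FinitelySupported {A : Type*} [MeasurableSpace A] (μ : Measure A) : Prop :=
  ∃ s : Finset A, μ (↑s)ᶜ = 0


/-- `K` is a version of the conditional distribution of the random element `V` given the
sub-σ-algebra `m`, under the measure `ρ`. -/
def IsCondDistrib' {Ω E : Type*} {mΩ : MeasurableSpace Ω} [MeasurableSpace E]
    (ρ : @Measure Ω mΩ) (V : Ω → E) (m : MeasurableSpace Ω) (K : Ω → Measure E) : Prop :=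
  (∀ ω, IsProbabilityMeasure (K ω)) ∧
  (∀ A : Set E, MeasurableSet A → Measurable[m] (fun ω => (K ω A).toReal)) ∧
  (∀ A : Set E, MeasurableSet A →
    (ρ[(V ⁻¹' A).indicator (fun _ => (1 : ℝ)) | m]) =ᵐ[ρ] fun ω => (K ω A).toReal)

/-- `Kμ` is a family of disintegration kernels of `μ` on a path space: `Kμ t` is a version of
the conditional distribution of the `t`-th coordinate given the past before `t`. -/
def IsDisintegration {X : Fin N → Type*} [∀ t, MeasurableSpace (X t)]
    (μ : Measure (∀ t, X t)) (Kμ : ∀ t : Fin N, (∀ s, X s) → Measure (X t)) : Prop :=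
  ∀ t : Fin N, IsCondDistrib' μ (fun x => x t) (pastσ X (t : ℕ)) (Kμ t)

variable {X Y : Fin N → Type*} [∀ t, MeasurableSpace (X t)] [∀ t, MeasurableSpace (Y t)]

open Classical in
/-- Membership in the dual building block `A_{X,μ,t}` (relative to a fixed family `Kμ` of
disintegration kernels of `μ`): for `t = 1` the bounded measurable functions of `x₁`; for
`t ≥ 2` functions `a_t(x_{1:t}, y_{1:t-1}) - ∫ a_t(x_{1:t-1}, x̃_t, y_{1:t-1}) μ_t^{x_{1:t-1}}(dx̃_t)`
with `a_t` bounded measurable. (Here `τ` is the 0-based coordinate index, `τ = t - 1`.) -/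
def MemAX (Kμ : ∀ t : Fin N, (∀ s, X s) → Measure (X t)) (τ : Fin N)
    (f : (∀ t, X t) × (∀ t, Y t) → ℝ) : Prop :=
  if (τ : ℕ) = 0 then
    ∃ a : (∀ t, X t) × (∀ t, Y t) → ℝ,
      Measurable[(coordσ X τ).comap Prod.fst] a ∧ (∃ M, ∀ ω, |a ω| ≤ M) ∧ f = a
  else
    ∃ a : (∀ t, X t) × (∀ t, Y t) → ℝ,
      Measurable[((pastσ X (τ : ℕ) ⊔ coordσ X τ).comap Prod.fst) ⊔
        ((pastσ Y (τ : ℕ)).comap Prod.snd)] a ∧ (∃ M, ∀ ω, |a ω| ≤ M) ∧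
      f = fun ω => a ω - ∫ x', a (Function.update ω.1 τ x', ω.2) ∂(Kμ τ ω.1)

open Classical in
/-- Membership in the dual building block `A_{Y,ν,t}` (symmetric to `MemAX`). -/
def MemAY (Kν : ∀ t : Fin N, (∀ s, Y s) → Measure (Y t)) (τ : Fin N)
    (f : (∀ t, X t) × (∀ t, Y t) → ℝ) : Prop :=
  if (τ : ℕ) = 0 then
    ∃ a : (∀ t, X t) × (∀ t, Y t) → ℝ,
      Measurable[(coordσ Y τ).comap Prod.snd] a ∧ (∃ M, ∀ ω, |a ω| ≤ M) ∧ f = a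
  else
    ∃ a : (∀ t, X t) × (∀ t, Y t) → ℝ,
      Measurable[((pastσ X (τ : ℕ)).comap Prod.fst) ⊔
        ((pastσ Y (τ : ℕ) ⊔ coordσ Y τ).comap Prod.snd)] a ∧ (∃ M, ∀ ω, |a ω| ≤ M) ∧
      f = fun ω => a ω - ∫ y', a (ω.1, Function.update ω.2 τ y') ∂(Kν τ ω.2)

/-- The dual space `S_{X,μ}`: sums `∑_{t=1}^N f_t` with `f_t ∈ A_{X,μ,t}`. -/
def MemSXμ (Kμ : ∀ t : Fin N, (∀ s, X s) → Measure (X t))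
    (s : (∀ t, X t) × (∀ t, Y t) → ℝ) : Prop :=
  ∃ f : Fin N → ((∀ t, X t) × (∀ t, Y t) → ℝ),
    (∀ τ, MemAX Kμ τ (f τ)) ∧ s = fun ω => ∑ τ, f τ ω

/-- The dual space `S_{Y,ν}`: sums `∑_{t=1}^N g_t` with `g_t ∈ A_{Y,ν,t}`. -/
def MemSYν (Kν : ∀ t : Fin N, (∀ s, Y s) → Measure (Y t))
    (s : (∀ t, X t) × (∀ t, Y t) → ℝ) : Prop :=
  ∃ g : Fin N → ((∀ t, X t) × (∀ t, Y t) → ℝ),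
    (∀ τ, MemAY Kν τ (g τ)) ∧ s = fun ω => ∑ τ, g τ ω

/-- The space `S_X` of bounded measurable functions depending only on `x`. -/
def MemSX (s : (∀ t, X t) × (∀ t, Y t) → ℝ) : Prop :=
  ∃ g : (∀ t, X t) → ℝ, Measurable g ∧ (∃ M, ∀ x, |g x| ≤ M) ∧ s = fun ω => g ω.1

/-- The space `S_Y` of bounded measurable functions depending only on `y`. -/
def MemSY (s : (∀ t, X t) × (∀ t, Y t) → ℝ) : Prop :=
  ∃ g : (∀ t, Y t) → ℝ, Measurable g ∧ (∃ M, ∀ y, |g y| ≤ M) ∧ s = fun ω => g ω.2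

/-- The dual space `H_•`: `H = S_X ⊕ S_Y`, `H_c = S_{X,μ} ⊕ S_Y`, `H_{ac} = S_X ⊕ S_{Y,ν}`,
`H_{bc} = S_{X,μ} ⊕ S_{Y,ν}`. -/
def MemH (Kμ : ∀ t : Fin N, (∀ s, X s) → Measure (X t))
    (Kν : ∀ t : Fin N, (∀ s, Y s) → Measure (Y t)) :
    Flavor → ((∀ t, X t) × (∀ t, Y t) → ℝ) → Prop
  | .plain => fun h => ∃ sX sY, MemSX (X := X) (Y := Y) sX ∧ MemSY sY ∧
      h = fun ω => sX ω + sY ω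
  | .causal => fun h => ∃ sX sY, MemSXμ Kμ sX ∧ MemSY sY ∧ h = fun ω => sX ω + sY ω
  | .anticausal => fun h => ∃ sX sY, MemSX (X := X) (Y := Y) sX ∧ MemSYν Kν sY ∧
      h = fun ω => sX ω + sY ω
  | .bicausal => fun h => ∃ sX sY, MemSXμ Kμ sX ∧ MemSYν Kν sY ∧ h = fun ω => sX ω + sY ω

/-- The set `Π_c(μ, ∗)` of causal measures with first marginal `μ` and arbitrary second
marginal. -/
def causalFirst (μ : Measure (∀ t, X t)) : Set (Measure ((∀ t, X t) × (∀ t, Y t))) :=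
  {π | π.map Prod.fst = μ ∧ IsCausal π}

/-- The set `Π(∗, ν)` of couplings with arbitrary first marginal and second marginal `ν`. -/
def secondMarg (ν : Measure (∀ t, Y t)) : Set (Measure ((∀ t, X t) × (∀ t, Y t))) :=
  {π | π.map Prod.snd = ν}

/-- The set `Π_{ac}(∗, ν)` of anticausal measures with second marginal `ν`. -/
def anticausalSecond (ν : Measure (∀ t, Y t)) : Set (Measure ((∀ t, X t) × (∀ t, Y t))) :=
  {π | π.map Prod.snd = ν ∧ IsAnticausal π}

/-- The reference measure `P_c` with `dP_c/dP = exp(-c)/∫ exp(-c) dP`. -/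
def Pc {Ω : Type*} [MeasurableSpace Ω] (P : Measure Ω) (c : Ω → ℝ) : Measure Ω :=
  P.withDensity
    (fun ω => ENNReal.ofReal (Real.exp (-c ω)) / ∫⁻ ω', ENNReal.ofReal (Real.exp (-c ω')) ∂P)

/-- Sinkhorn's algorithm: `full 0 = π0`; `half k` is the `D_KL`-projection of `full k`
onto `Q1`, and `full (k+1)` is the `D_KL`-projection of `half k` onto `Q2`. -/
structure IsSinkhorn {Ω : Type*} [MeasurableSpace Ω] (Q1 Q2 : Set (Measure Ω))
    (π0 : Measure Ω) (full half : ℕ → Measure Ω) : Prop where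
  init : full 0 = π0
  half_mem : ∀ k, half k ∈ Q1
  half_opt : ∀ k, ∀ ρ ∈ Q1, KL (half k) (full k) ≤ KL ρ (full k)
  full_mem : ∀ k, full (k + 1) ∈ Q2
  full_opt : ∀ k, ∀ ρ ∈ Q2, KL (full (k + 1)) (half k) ≤ KL ρ (half k)

/-- The second projection set of Sinkhorn's algorithm: `Π(∗, ν)` for the causal problem and
`Π_{ac}(∗, ν)` for the bicausal problem. -/
def sinkQ2 (b : Flavor) (ν : Measure (∀ t, Y t)) : Set (Measure ((∀ t, X t) × (∀ t, Y t))) :=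
  match b with
  | .bicausal => anticausalSecond ν
  | _ => secondMarg ν

/-- The dual class of the second Sinkhorn potential: `S_Y` for the causal problem,
`S_{Y,ν}` for the bicausal problem. -/
def MemG (Kν : ∀ t : Fin N, (∀ s, Y s) → Measure (Y t)) :
    Flavor → ((∀ t, X t) × (∀ t, Y t) → ℝ) → Prop
  | .bicausal => fun g => MemSYν Kν g
  | _ => fun g => MemSY g

/-- Real-valued entropic transport value (`ε = 1`), the infimum being taken over couplings
with finite relative entropy. -/
def Efin (b : Flavor) (μ : Measure (∀ t, X t)) (ν : Measure (∀ t, Y t))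
    (c : (∀ t, X t) × (∀ t, Y t) → ℝ) : ℝ :=
  ⨅ π : {π : Measure ((∀ t, X t) × (∀ t, Y t)) //
      π ∈ aCouplings b μ ν ∧ KL π (μ.prod ν) ≠ ⊤},
    (∫ z, c z ∂π.1 + (KL π.1 (μ.prod ν)).toReal)

section CondExp

variable {Ω : Type*} {m₁ m₃ m₀ : MeasurableSpace Ω} {μ : Measure Ω}

/-- The intersections of sets from two σ-algebras generate their supremum. -/
lemma sup_eq_generateFrom_inter (m₁ m₃ : MeasurableSpace Ω) :
    m₁ ⊔ m₃ = MeasurableSpace.generateFrom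
      {s | ∃ A C, MeasurableSet[m₁] A ∧ MeasurableSet[m₃] C ∧ s = A ∩ C} := by
  refine le_antisymm (sup_le ?_ ?_) (MeasurableSpace.generateFrom_le ?_)
  · exact fun A hA => MeasurableSpace.measurableSet_generateFrom
      ⟨A, univ, hA, MeasurableSet.univ, (inter_univ A).symm⟩
  · exact fun C hC => MeasurableSpace.measurableSet_generateFrom
      ⟨univ, C, MeasurableSet.univ, hC, (univ_inter C).symm⟩
  · rintro _ ⟨A, C, hA, hC, rfl⟩
    exact MeasurableSet.inter ((le_sup_left : m₁ ≤ m₁ ⊔ m₃) A hA)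
      ((le_sup_right : m₃ ≤ m₁ ⊔ m₃) C hC)

lemma isPiSystem_inter_measurableSet (m₁ m₃ : MeasurableSpace Ω) :
    IsPiSystem {s | ∃ A C, MeasurableSet[m₁] A ∧ MeasurableSet[m₃] C ∧ s = A ∩ C} := by
  rintro _ ⟨A, C, hA, hC, rfl⟩ _ ⟨A', C', hA', hC', rfl⟩ -
  exact ⟨A ∩ A', C ∩ C', MeasurableSet.inter hA hA', MeasurableSet.inter hC hC',
    inter_inter_inter_comm A C A' C'⟩

/-- If an integrable function is conditionally uncorrelated, given `m₃`, with the indicators of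
the sets of `m₁`, then conditioning it on `m₁ ⊔ m₃` is the same as conditioning it on `m₃`. -/
lemma condExp_sup_ae_eq [IsFiniteMeasure μ] (h₁ : m₁ ≤ m₀) (h₃ : m₃ ≤ m₀) {k : Ω → ℝ}
    (hk : Integrable k μ)
    (h : ∀ A, MeasurableSet[m₁] A →
      μ[A.indicator k | m₃] =ᵐ[μ] μ[A.indicator (fun _ => (1 : ℝ)) | m₃] * μ[k | m₃]) :
    μ[k | m₁ ⊔ m₃] =ᵐ[μ] μ[k | m₃] := by
  have h13 : m₁ ⊔ m₃ ≤ m₀ := sup_le h₁ h₃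
  have key : ∀ s, MeasurableSet[m₁ ⊔ m₃] s → ∫ x in s, (μ[k | m₃]) x ∂μ = ∫ x in s, k x ∂μ := by
    refine MeasurableSpace.induction_on_inter (m := m₁ ⊔ m₃)
      (C := fun s _ => ∫ x in s, (μ[k | m₃]) x ∂μ = ∫ x in s, k x ∂μ)
      (sup_eq_generateFrom_inter m₁ m₃) (isPiSystem_inter_measurableSet m₁ m₃) ?_ ?_ ?_ ?_
    · simp
    · rintro _ ⟨A, C, hA, hC, rfl⟩
      have hA0 := h₁ A hA
      have hmul : A.indicator (μ[k | m₃]) = A.indicator (fun _ => (1 : ℝ)) * μ[k | m₃] := by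
        ext x; by_cases hx : x ∈ A <;> simp [hx]
      have hint : Integrable (A.indicator (μ[k | m₃])) μ := integrable_condExp.indicator hA0
      have hpull : μ[A.indicator (μ[k | m₃]) | m₃] =ᵐ[μ] μ[A.indicator k | m₃] := by
        refine EventuallyEq.trans ?_ (h A hA).symm
        rw [hmul] at hint ⊢
        exact condExp_mul_of_stronglyMeasurable_right stronglyMeasurable_condExp hint
          ((integrable_const 1).indicator hA0)
      rw [inter_comm, ← setIntegral_indicator hA0, ← setIntegral_indicator hA0,
        ← setIntegral_condExp h₃ hint hC, ← setIntegral_condExp h₃ (hk.indicator hA0) hC]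
      exact integral_congr_ae (ae_restrict_of_ae hpull)
    · intro t ht hC
      have e₁ := integral_add_compl (h13 t ht) (integrable_condExp (f := k) (μ := μ) (m := m₃))
      have e₂ := integral_add_compl (h13 t ht) hk
      have e₃ := integral_condExp h₃ (f := k) (μ := μ)
      linarith
    · intro f hd hf hC
      rw [integral_iUnion (fun i => h13 _ (hf i)) hd integrable_condExp.integrableOn,
        integral_iUnion (fun i => h13 _ (hf i)) hd hk.integrableOn]
      exact tsum_congr hC
  exact (ae_eq_condExp_of_forall_setIntegral_eq h13 hk
    (fun s _ _ => integrable_condExp.integrableOn) (fun s hs _ => key s hs)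
    (stronglyMeasurable_condExp.mono (le_sup_right : m₃ ≤ m₁ ⊔ m₃)).aestronglyMeasurable).symm

end CondExp

section Kernel

variable {A B : Type*} {m m₁ m₃ : MeasurableSpace A} {m' m₂ : MeasurableSpace B}
  {mA : MeasurableSpace A} {mB : MeasurableSpace B} {μ : Measure A} {K : Kernel A B}

/-- Conditional expectations given information on the first component only may be computed by
first integrating out the second component. -/
lemma condExp_compProd_comap_fst [IsFiniteMeasure μ] [IsMarkovKernel K]
    (hm : m ≤ mA) {f : A × B → ℝ} (hf : Integrable f (μ ⊗ₘ K)) :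
    (μ ⊗ₘ K)[f | m.comap Prod.fst] =ᵐ[μ ⊗ₘ K]
      (μ[fun x => ∫ y, f (x, y) ∂(K x) | m]) ∘ Prod.fst := by
  have hm' : m.comap Prod.fst ≤ mA.prod mB :=
    (MeasurableSpace.comap_mono hm).trans measurable_fst.comap_le
  have hmp : MeasurePreserving Prod.fst (μ ⊗ₘ K) μ :=
    ⟨measurable_fst, Measure.fst_compProd μ K⟩
  have hF : Integrable (fun x => ∫ y, f (x, y) ∂(K x)) μ := by
    simpa using Integrable.integral_compProd (κ := Kernel.const Unit μ) (a := ())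
      (η := Kernel.prodMkLeft Unit K) hf
  have hint : Integrable ((μ[fun x => ∫ y, f (x, y) ∂(K x) | m]) ∘ Prod.fst) (μ ⊗ₘ K) :=
    hmp.integrable_comp_of_integrable integrable_condExp
  refine (ae_eq_condExp_of_forall_setIntegral_eq hm' hf (fun _ _ _ => hint.integrableOn) ?_
    ?_).symm
  · rintro _ ⟨C, hC, rfl⟩ -
    have hprod : (Prod.fst ⁻¹' C : Set (A × B)) = C ×ˢ univ := by ext; simp
    rw [hprod, Measure.setIntegral_compProd (hm C hC) MeasurableSet.univ hint.integrableOn,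
      Measure.setIntegral_compProd (hm C hC) MeasurableSet.univ hf.integrableOn]
    simpa using setIntegral_condExp hm hF hC
  · exact (stronglyMeasurable_condExp.comp_measurable
      (comap_measurable Prod.fst)).aestronglyMeasurable

lemma condExp_compProd_indicator [IsFiniteMeasure μ] [IsMarkovKernel K]
    (hm : m ≤ mA) {C : Set A} {S : Set B} (hC : MeasurableSet C) (hS : MeasurableSet S) :
    (μ ⊗ₘ K)[(Prod.fst ⁻¹' C ∩ Prod.snd ⁻¹' S).indicator (fun _ => (1 : ℝ)) | m.comap Prod.fst]
      =ᵐ[μ ⊗ₘ K] (μ[C.indicator (fun x => (K x).real S) | m]) ∘ Prod.fst := by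
  have hCS : MeasurableSet (Prod.fst ⁻¹' C ∩ Prod.snd ⁻¹' S : Set (A × B)) :=
    (measurable_fst hC).inter (measurable_snd hS)
  have h := condExp_compProd_comap_fst (μ := μ) (K := K) hm
    ((integrable_const (1 : ℝ)).indicator hCS)
  have hfun : (fun x => ∫ y, (Prod.fst ⁻¹' C ∩ Prod.snd ⁻¹' S : Set (A × B)).indicator
      (fun _ => (1 : ℝ)) (x, y) ∂(K x)) = C.indicator (fun x => (K x).real S) := by
    ext x
    by_cases hx : x ∈ C
    · rw [indicator_of_mem hx, ← integral_indicator_one hS]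
      exact integral_congr_ae (.of_forall fun y => by by_cases hy : y ∈ S <;> simp [hx, hy])
    · simp [hx]
  rwa [hfun] at h

/-- Under `μ ⊗ₘ K`, conditional independence given a sub-σ-algebra of the first component is a
statement about `μ` and the functions `x ↦ K x S`. -/
lemma condIndepσ_compProd_iff [IsFiniteMeasure μ] [IsMarkovKernel K]
    (h₁ : m₁ ≤ mA) (h₂ : m₂ ≤ mB) (h₃ : m₃ ≤ mA) :
    CondIndepσ (m₁.comap Prod.fst) (m₂.comap Prod.snd) (m₃.comap Prod.fst) (μ ⊗ₘ K) ↔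
      ∀ C S, MeasurableSet[m₁] C → MeasurableSet[m₂] S →
        μ[C.indicator (fun x => (K x).real S) | m₃] =ᵐ[μ]
          μ[C.indicator (fun _ => (1 : ℝ)) | m₃] * μ[fun x => (K x).real S | m₃] := by
  have transfer : ∀ {f g : A → ℝ}, StronglyMeasurable[m₃] f → StronglyMeasurable[m₃] g →
      (f ∘ Prod.fst =ᵐ[μ ⊗ₘ K] g ∘ Prod.fst ↔ f =ᵐ[μ] g) := by
    intro f g hf hg
    have hs := (hf.mono h₃).measurableSet_eq_fun (hg.mono h₃)
    have := ae_map_iff (μ := μ ⊗ₘ K) measurable_fst.aemeasurable hs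
    rw [← Measure.fst, Measure.fst_compProd] at this
    exact this.symm
  have main : ∀ C S, MeasurableSet[m₁] C → MeasurableSet[m₂] S →
      ((μ ⊗ₘ K)[(Prod.fst ⁻¹' C ∩ Prod.snd ⁻¹' S).indicator (fun _ => (1 : ℝ))
          | m₃.comap Prod.fst] =ᵐ[μ ⊗ₘ K]
        (μ ⊗ₘ K)[(Prod.fst ⁻¹' C).indicator (fun _ => (1 : ℝ)) | m₃.comap Prod.fst] *
        (μ ⊗ₘ K)[(Prod.snd ⁻¹' S).indicator (fun _ => (1 : ℝ)) | m₃.comap Prod.fst] ↔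
      μ[C.indicator (fun x => (K x).real S) | m₃] =ᵐ[μ]
        μ[C.indicator (fun _ => (1 : ℝ)) | m₃] * μ[fun x => (K x).real S | m₃]) := by
    intro C S hC hS
    have e := condExp_compProd_indicator (μ := μ) (K := K) h₃ (h₁ C hC) (h₂ S hS)
    have eC := condExp_compProd_indicator (μ := μ) (K := K) h₃ (h₁ C hC) MeasurableSet.univ
    have eS := condExp_compProd_indicator (μ := μ) (K := K) h₃ MeasurableSet.univ (h₂ S hS)
    simp only [preimage_univ, inter_univ, univ_inter, indicator_univ, probReal_univ] at eC eS
    rw [← transfer stronglyMeasurable_condExp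
      (stronglyMeasurable_condExp.mul stronglyMeasurable_condExp)]
    exact ⟨fun h => e.symm.trans (h.trans (eC.mul eS)),
      fun h => e.trans (h.trans (eC.mul eS).symm)⟩
  constructor
  · exact fun h C S hC hS => (main C S hC hS).1 (h _ _ ⟨C, hC, rfl⟩ ⟨S, hS, rfl⟩)
  · rintro h _ _ ⟨C, hC, rfl⟩ ⟨S, hS, rfl⟩
    exact (main C S hC hS).2 (h C S hC hS)

lemma integrable_kernel_real [IsFiniteMeasure μ] [IsMarkovKernel K] {S : Set B}
    (hS : MeasurableSet S) : Integrable (fun x => (K x).real S) μ :=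
  Integrable.of_bound (K.measurable_coe hS).ennreal_toReal.aestronglyMeasurable 1
    (.of_forall fun x => by simp [abs_of_nonneg])

/-- If `x ↦ K x S` is a.e. `m`-measurable for all `S` in a σ-algebra `m'`, then so is the
integral against `K` of any `m'`-measurable function. -/
lemma aestronglyMeasurable_lintegral_kernel (hm' : m' ≤ mB)
    (h : ∀ S, MeasurableSet[m'] S → AEStronglyMeasurable[m] (fun x => K x S) μ)
    {g : B → ℝ≥0∞} (hg : Measurable[m'] g) :
    AEStronglyMeasurable[m] (fun x => ∫⁻ y, g y ∂(K x)) μ := by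
  refine Measurable.ennreal_induction (mα := m')
    (motive := fun g => AEStronglyMeasurable[m] (fun x => ∫⁻ y, g y ∂(K x)) μ) ?_ ?_ ?_ hg
  · intro c S hS
    obtain ⟨f, hf, hfe⟩ := h S hS
    refine ⟨fun x => c * f x, (hf.measurable.const_mul c).stronglyMeasurable, ?_⟩
    filter_upwards [hfe] with x hx
    rw [lintegral_indicator (hm' S hS), setLIntegral_const, hx]
  · intro f₁ f₂ _ hf₁ _ h₁ h₂
    simp only [Pi.add_apply]
    simp_rw [lintegral_add_left (hf₁.mono hm' le_rfl)]
    exact h₁.add h₂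
  · intro f hf hmono hP
    choose F hF hFe using hP
    refine ⟨fun x => ⨆ n, F n x,
      (Measurable.iSup fun n => (hF n).measurable).stronglyMeasurable, ?_⟩
    filter_upwards [ae_all_iff.2 hFe] with x hx
    rw [lintegral_iSup (fun n => (hf n).mono hm' le_rfl) hmono]
    exact iSup_congr hx

lemma aestronglyMeasurable_kernel_iff [IsMarkovKernel K] {S : Set B} :
    AEStronglyMeasurable[m] (fun x => (K x).real S) μ ↔
      AEStronglyMeasurable[m] (fun x => K x S) μ := by
  constructor
  · rintro ⟨f, hf, hfe⟩
    refine ⟨fun x => ENNReal.ofReal (f x), hf.measurable.ennreal_ofReal.stronglyMeasurable, ?_⟩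
    filter_upwards [hfe] with x hx
    rw [← hx, ofReal_measureReal]
  · rintro ⟨f, hf, hfe⟩
    refine ⟨fun x => (f x).toReal, hf.measurable.ennreal_toReal.stronglyMeasurable, ?_⟩
    filter_upwards [hfe] with x hx
    rw [← hx, measureReal_def]

/-- Kernels that are a.e. adapted compose to an a.e. adapted kernel. -/
lemma aestronglyMeasurable_comp_kernel {C : Type*} {mC : MeasurableSpace C} {L : Kernel B C}
    (hm' : m' ≤ mB)
    (hK : ∀ S, MeasurableSet[m'] S → AEStronglyMeasurable[m] (fun x => K x S) μ)
    {S : Set C} (hS : MeasurableSet S)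
    (hL : AEStronglyMeasurable[m'] (fun y => L y S) (K ∘ₘ μ)) :
    AEStronglyMeasurable[m] (fun x => (L ∘ₖ K) x S) μ := by
  obtain ⟨g, hg, hge⟩ := hL
  refine (aestronglyMeasurable_lintegral_kernel hm' hK hg.measurable).congr ?_
  filter_upwards [Measure.ae_ae_of_ae_comp hge] with x hx
  rw [Kernel.comp_apply' _ _ _ hS]
  exact lintegral_congr_ae (EventuallyEq.symm hx)

end Kernel

section Causal

variable {N : ℕ} {X Y : Fin N → Type*} [∀ t, MeasurableSpace (X t)] [∀ t, MeasurableSpace (Y t)]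

lemma coordσ_le (t : Fin N) : coordσ X t ≤ MeasurableSpace.pi :=
  (measurable_pi_apply t).comap_le

lemma pastσ_le (t : ℕ) : pastσ X t ≤ MeasurableSpace.pi :=
  iSup₂_le fun s _ => coordσ_le s

lemma pastσ_mono {s t : ℕ} (hst : s ≤ t) : pastσ X s ≤ pastσ X t :=
  iSup₂_le fun r hr => le_iSup₂_of_le r (hr.trans_le hst) le_rfl

lemma pi_le_pastσ : MeasurableSpace.pi ≤ pastσ X N :=
  iSup_le fun s => le_iSup₂_of_le s s.2 le_rfl

lemma pastσ_succ_le (t : Fin N) : pastσ X (t + 1) ≤ coordσ X t ⊔ pastσ X t := by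
  refine iSup₂_le fun s hs => ?_
  rcases Nat.lt_succ_iff_lt_or_eq.1 hs with h | h
  · exact le_sup_of_le_right (le_iSup₂_of_le s h le_rfl)
  · rw [Fin.ext h]
    exact le_sup_left

/-- The coupling `μ ⊗ₘ K` is causal iff, for each `t` and each event `S` depending on the past of
`Y` before `t`, the function `x ↦ K x S` depends a.e. only on the past of `x` before `t`. -/
lemma isCausal_compProd_iff {μ : Measure (∀ t, X t)} [IsFiniteMeasure μ]
    {K : Kernel (∀ t, X t) (∀ t, Y t)} [IsMarkovKernel K] :
    IsCausal (μ ⊗ₘ K) ↔ ∀ t : Fin N, ∀ S, MeasurableSet[pastσ Y t] S →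
      AEStronglyMeasurable[pastσ X t] (fun x => (K x).real S) μ := by
  have hiff : ∀ t : Fin N, _ := fun t => condIndepσ_compProd_iff (μ := μ) (K := K)
    (coordσ_le t) (pastσ_le t) (pastσ_le t)
  constructor
  · intro h t S hS
    have hint : Integrable (fun x => (K x).real S) μ := integrable_kernel_real (pastσ_le t S hS)
    refine Nat.decreasingInduction' (m := t) (n := N)
      (P := fun s => AEStronglyMeasurable[pastσ X s] (fun x => (K x).real S) μ) ?_ t.2.le ?_
    · intro s hs hts ih
      have hsup := condExp_sup_ae_eq (coordσ_le ⟨s, hs⟩) (pastσ_le s) hint fun C hC =>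
        (hiff ⟨s, hs⟩).1 (h ⟨s, hs⟩) C S hC (pastσ_mono hts S hS)
      have hself := condExp_of_aestronglyMeasurable'
        (sup_le (coordσ_le ⟨s, hs⟩) (pastσ_le s)) (ih.mono (pastσ_succ_le ⟨s, hs⟩)) hint
      exact ⟨_, stronglyMeasurable_condExp, hself.symm.trans hsup⟩
    · exact hint.1.mono pi_le_pastσ
  · intro h t
    refine (hiff t).2 fun C S hC hS => ?_
    have hC' := coordσ_le t C hC
    have hint : Integrable (fun x => (K x).real S) μ := integrable_kernel_real (pastσ_le t S hS)
    have hmul : C.indicator (fun x => (K x).real S) =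
        C.indicator (fun _ => (1 : ℝ)) * fun x => (K x).real S := by
      ext x; by_cases hx : x ∈ C <;> simp [hx]
    have hprod := hint.indicator hC'
    rw [hmul] at hprod ⊢
    refine (condExp_mul_of_aestronglyMeasurable_right (h t S hS) hprod
      ((integrable_const 1).indicator hC')).trans ?_
    exact EventuallyEq.rfl.mul
      (condExp_of_aestronglyMeasurable' (pastσ_le t) (h t S hS) hint).symm

end Causal

/-- Concatenation of causal couplings via kernel convolution is causal:
if `π = μ ⊗ K ∈ Π_c(μ, ν)` and `π̃ = ν ⊗ K̃ ∈ Π_c(ν, γ)`, then `μ ⊗ (K ∗ K̃) ∈ Π_c(μ, γ)`. -/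
theorem stmt_0 {N : ℕ} (X Y Z : Fin N → Type*)
    [∀ t, MeasurableSpace (X t)] [∀ t, TopologicalSpace (X t)]
    [∀ t, PolishSpace (X t)] [∀ t, BorelSpace (X t)]
    [∀ t, MeasurableSpace (Y t)] [∀ t, TopologicalSpace (Y t)]
    [∀ t, PolishSpace (Y t)] [∀ t, BorelSpace (Y t)]
    [∀ t, MeasurableSpace (Z t)] [∀ t, TopologicalSpace (Z t)]
    [∀ t, PolishSpace (Z t)] [∀ t, BorelSpace (Z t)]
    (μ : Measure (∀ t, X t)) (ν : Measure (∀ t, Y t)) (γ : Measure (∀ t, Z t))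
    [IsProbabilityMeasure μ] [IsProbabilityMeasure ν] [IsProbabilityMeasure γ]
    (K : Kernel (∀ t, X t) (∀ t, Y t)) [IsMarkovKernel K]
    (K' : Kernel (∀ t, Y t) (∀ t, Z t)) [IsMarkovKernel K']
    (π : Measure ((∀ t, X t) × (∀ t, Y t))) (π' : Measure ((∀ t, Y t) × (∀ t, Z t)))
    (hπK : π = μ ⊗ₘ K) (hπ : π ∈ aCouplings .causal μ ν)
    (hπ'K : π' = ν ⊗ₘ K') (hπ' : π' ∈ aCouplings .causal ν γ) :
    μ ⊗ₘ (K' ∘ₖ K) ∈ aCouplings .causal μ γ := by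
  subst hπK hπ'K
  obtain ⟨⟨-, hν⟩, hK⟩ := hπ
  obtain ⟨⟨-, hγ⟩, hK'⟩ := hπ'
  have hν' : K ∘ₘ μ = ν := (Measure.snd_compProd μ K).symm.trans hν
  have hγ' : K' ∘ₘ ν = γ := (Measure.snd_compProd ν K').symm.trans hγ
  refine ⟨⟨Measure.fst_compProd μ (K' ∘ₖ K), ?_⟩, ?_⟩
  · rw [← Measure.snd, Measure.snd_compProd, ← Measure.comp_assoc, hν', hγ']
  · refine isCausal_compProd_iff.2 fun t S hS => aestronglyMeasurable_kernel_iff.2 ?_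
    refine aestronglyMeasurable_comp_kernel (pastσ_le t)
      (fun T hT => aestronglyMeasurable_kernel_iff.1 (isCausal_compProd_iff.1 hK t T hT))
      (pastσ_le t S hS) ?_
    rw [hν']
    exact aestronglyMeasurable_kernel_iff.1 (isCausal_compProd_iff.1 hK' t S hS)

end AOT
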